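/- arXiv:1602.02318 — 5 statements merged into one kernel-verified Lean document; each statement's English description precedes it below -/
import Mathlib

section
/- Let 2 ≤ k ≤ m and let a = {a_1,a_2} and b be (m+1)-diagonals of P_{n,m}. If b is a 1-neighbour of Σ^{k−1}a having a_1+k or a_2+k as an endpoint, then b is a k-neighbour of a. -/
namespace PaperTiling

variable {M : ℕ}

/-- `[i,j]`: the number of vertices encountered travelling clockwise from `i` to `j`, inclusive. -/
def cnt (i j : ZMod M) : ℕ := (j - i).val + 1

/-- `C(v₁,…,v_r)`: the entries are pairwise distinct and occur in this clockwise cyclic order. -/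
def CW (l : List (ZMod M)) : Prop :=
  l.Nodup ∧ ((l.zip (l.rotate 1)).map fun p => (p.2 - p.1).val).sum = M

/-- Two diagonals cross. -/
def Crosses (d e : Sym2 (ZMod M)) : Prop :=
  ∃ a1 b1 a2 b2 : ZMod M, d = s(a1, a2) ∧ e = s(b1, b2) ∧ CW [a1, b1, a2, b2]

/-- `d` is an `(m+1)`-diagonal. -/
def IsMDiag (m : ℕ) (d : Sym2 (ZMod M)) : Prop :=
  ¬ d.IsDiag ∧ ∀ i j : ZMod M, d = s(i, j) → (m + 1) ∣ cnt i j

/-- Short diagonal. -/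
def IsShort (m : ℕ) (d : Sym2 (ZMod M)) : Prop :=
  ∃ v : ZMod M, d = s(v, v + (m : ZMod M))

/-- Long diagonal. -/
def IsLong (m : ℕ) (d : Sym2 (ZMod M)) : Prop := IsMDiag m d ∧ ¬ IsShort m d

/-- The shift `Σ^k`. -/
def shiftD (k : ℕ) (d : Sym2 (ZMod M)) : Sym2 (ZMod M) :=
  d.map (fun v => v + (k : ZMod M))

/-- `a` and `b` are `k`-neighbours. -/
def Nbr (k : ℕ) (a b : Sym2 (ZMod M)) : Prop :=
  a ≠ b ∧ ¬ Crosses a b ∧ ∃ v ∈ a, ((v + (k : ZMod M)) ∈ b ∨ (v - (k : ZMod M)) ∈ b)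

/-- The Ext-hammock condition `E_k(b,a)`. -/
def Ek (m k : ℕ) (b a : Sym2 (ZMod M)) : Prop :=
  (Nbr k a b ∧ ∃ v ∈ a, (v + (k : ZMod M)) ∈ b) ∨
  (∃ a1 b1 a2 b2 : ZMod M, a = s(a1, a2) ∧ b = s(b1, b2) ∧ CW [a1, b1, a2, b2] ∧
    (∃ x : ℕ, 1 ≤ x ∧ cnt a1 b1 = x * (m + 1) + k) ∧
    (∃ x : ℕ, 1 ≤ x ∧ cnt a2 b2 = x * (m + 1) + k)) ∨
  b = shiftD k a

/-- `S` is `m`-rigid. -/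
def MRigid (m : ℕ) (S : Set (Sym2 (ZMod M))) : Prop :=
  ∀ a ∈ S, ∀ b ∈ S, ∀ k : ℕ, 1 ≤ k → k ≤ m → ¬ Ek m k b a

/-- `S` is maximal `m`-rigid (among sets of `(m+1)`-diagonals). -/
def MaxMRigid (m : ℕ) (S : Set (Sym2 (ZMod M))) : Prop :=
  (∀ d ∈ S, IsMDiag m d) ∧ MRigid m S ∧
  ∀ d : Sym2 (ZMod M), IsMDiag m d → d ∉ S → ¬ MRigid m (insert d S)

/-- `v` lies on no diagonal of `S`. -/
def Isolated (S : Set (Sym2 (ZMod M))) (v : ZMod M) : Prop := ∀ d ∈ S, v ∉ d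

/-- The graph of `S`. -/
def graphOf (S : Set (Sym2 (ZMod M))) : SimpleGraph (ZMod M) := SimpleGraph.fromEdgeSet S

/-- The induced subgraph of the graph of `S` on non-isolated vertices is connected. -/
def ConnectedSet (S : Set (Sym2 (ZMod M))) : Prop :=
  ((graphOf S).induce {v : ZMod M | ¬ Isolated S v}).Connected

/-- A tiling: a set of pairwise noncrossing diagonals. -/
def IsTiling (S : Set (Sym2 (ZMod M))) : Prop :=
  (∀ d ∈ S, ¬ d.IsDiag) ∧ ∀ d ∈ S, ∀ e ∈ S, ¬ Crosses d e

/-- The tile of `S` adjacent to the diagonal `{a,b}` on the side of the clockwise arc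
from `a` to `b`. -/
def tileAt (S : Set (Sym2 (ZMod M))) (a b : ZMod M) : Set (ZMod M) :=
  {v | cnt a v ≤ cnt a b ∧
    ∀ c e : ZMod M, s(c, e) ∈ S → s(c, e) ≠ s(a, b) →
      cnt a c ≤ cnt a e → cnt a e ≤ cnt a b →
      ¬ (cnt a c < cnt a v ∧ cnt a v < cnt a e)}

def IsTile (S : Set (Sym2 (ZMod M))) (T : Set (ZMod M)) : Prop :=
  ∃ a b : ZMod M, s(a, b) ∈ S ∧ T = tileAt S a b

/-- `d` is a bounding diagonal of the tile `T`. -/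
def IsBounding (S : Set (Sym2 (ZMod M))) (T : Set (ZMod M)) (d : Sym2 (ZMod M)) : Prop :=
  d ∈ S ∧ ∀ v ∈ d, v ∈ T

/-- The length `ℓ(T)` of a tile: the number of its bounding diagonals. -/
noncomputable def tileLen (S : Set (Sym2 (ZMod M))) (T : Set (ZMod M)) : ℕ :=
  {d | IsBounding S T d}.ncard

/-- `v` is strictly clockwise between `p` and `q`. -/
def StrictIn (p q v : ZMod M) : Prop := 1 < cnt p v ∧ cnt p v < cnt p q

/-- `(p,q)` is an open boundary of the tile `T`. -/
def IsOpenBdry (S : Set (Sym2 (ZMod M))) (T : Set (ZMod M)) (p q : ZMod M) : Prop :=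
  p ≠ q ∧ p ∈ T ∧ q ∈ T ∧
  (∃ d, IsBounding S T d ∧ p ∈ d) ∧ (∃ d, IsBounding S T d ∧ q ∈ d) ∧
  (∀ v : ZMod M, StrictIn p q v → v ∈ T ∧ Isolated S v) ∧
  (∀ d, IsBounding S T d → d ≠ s(p, q) → ∀ v ∈ d, ¬ StrictIn p q v)

def IsOpenTile (S : Set (Sym2 (ZMod M))) (T : Set (ZMod M)) : Prop :=
  ∃ p q, IsOpenBdry S T p q

/-- Tile of type `(ℓ, b)` with `b ≥ 1`. -/
def HasOpenType (S : Set (Sym2 (ZMod M))) (T : Set (ZMod M)) (l b : ℕ) : Prop :=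
  tileLen S T = l ∧ ∃ p q, IsOpenBdry S T p q ∧ cnt p q - 1 = b

/-- Tile of type `(ℓ, 0)`. -/
def HasClosedType (S : Set (Sym2 (ZMod M))) (T : Set (ZMod M)) (l : ℕ) : Prop :=
  tileLen S T = l ∧ ¬ IsOpenTile S T

/-- The list of possible tile types from Proposition 2.9. -/
def GoodTiles (m : ℕ) (S : Set (Sym2 (ZMod M))) : Prop :=
  ∀ T : Set (ZMod M), IsTile S T →
    (∃ k, 1 ≤ k ∧ k ≤ m + 1 ∧ HasOpenType S T k (m + k - 1)) ∨
    (tileLen S T = m + 2 ∧ ∃ p q, IsOpenBdry S T p q ∧ cnt p q - 1 = 2 * m + 1 ∧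
      ∃ d, IsBounding S T d ∧ (p ∈ d ∨ q ∈ d) ∧ IsShort m d) ∨
    HasOpenType S T 1 (2 * m + 1) ∨
    (tileLen S T = m + 3 ∧ ∃ p q, IsOpenBdry S T p q ∧ cnt p q - 1 = m + 1 ∧
      ∀ d, IsBounding S T d → (p ∈ d ∨ q ∈ d) → IsShort m d) ∨
    HasClosedType S T (m + 3)

/-- A quiver (arrow relation) with a set of length-two relation paths. -/
structure GPair (V : Type) where
  Arr : V → V → Prop
  Rel : V → V → V → Prop

namespace GPair

variable {V : Type} (G : GPair V)

def IsGentle : Prop :=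
  (∀ x y z, G.Rel x y z → G.Arr x y ∧ G.Arr y z) ∧
  (∀ x, ¬ G.Arr x x) ∧
  (∀ x y, G.Arr x y → ¬ G.Arr y x) ∧
  (∀ x, {y | G.Arr x y}.encard ≤ 2) ∧
  (∀ x, {y | G.Arr y x}.encard ≤ 2) ∧
  (∀ x y, G.Arr x y → {z | G.Arr y z ∧ ¬ G.Rel x y z}.encard ≤ 1) ∧
  (∀ x y, G.Arr x y → {w | G.Arr w x ∧ ¬ G.Rel w x y}.encard ≤ 1) ∧
  (∀ x y, G.Arr x y → {z | G.Arr y z ∧ G.Rel x y z}.encard ≤ 1) ∧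
  (∀ x y, G.Arr x y → {w | G.Arr w x ∧ G.Rel w x y}.encard ≤ 1)

/-- The underlying undirected graph is connected. -/
def Conn : Prop := (SimpleGraph.fromRel G.Arr).Connected

def OrientedCycle (r : ℕ) (v : ZMod r → V) : Prop :=
  3 ≤ r ∧ Function.Injective v ∧ ∀ i : ZMod r, G.Arr (v i) (v (i + 1))

def UndirCycle (r : ℕ) (v : ZMod r → V) : Prop :=
  3 ≤ r ∧ Function.Injective v ∧ ∀ i : ZMod r, G.Arr (v i) (v (i + 1)) ∨ G.Arr (v (i + 1)) (v i)

/-- All cycles are oriented and relation-full. -/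
def CyclesOrientedFull : Prop :=
  (∀ (r : ℕ) (v : ZMod r → V), G.UndirCycle r v →
    (∀ i, G.Arr (v i) (v (i + 1))) ∨ ∀ i, G.Arr (v (i + 1)) (v i)) ∧
  ∀ (r : ℕ) (v : ZMod r → V), G.OrientedCycle r v →
    ∀ i : ZMod r, G.Rel (v i) (v (i + 1)) (v (i + 2))

/-- The valency of a vertex: the number of arrows incident with it. -/
noncomputable def valency (x : V) : ℕ∞ := {y | G.Arr x y}.encard + {y | G.Arr y x}.encard

/-- A (non-trivial) permitted path, recorded by its list of vertices. -/
def PermPath (l : List V) : Prop :=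
  2 ≤ l.length ∧ l.Chain' G.Arr ∧ ∀ x y z : V, [x, y, z] <:+: l → ¬ G.Rel x y z

/-- A (non-trivial) forbidden path, recorded by its list of vertices. -/
def ForbPath (l : List V) : Prop :=
  2 ≤ l.length ∧ l.Chain' G.Arr ∧ (l.zip l.tail).Nodup ∧
    ∀ x y z : V, [x, y, z] <:+: l → G.Rel x y z

def TrivPermVtx (v : V) : Prop :=
  {y | G.Arr v y}.Subsingleton ∧ {y | G.Arr y v}.Subsingleton ∧
  ∀ x y, G.Arr x v → G.Arr v y → ¬ G.Rel x v y

def TrivForbVtx (v : V) : Prop :=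
  {y | G.Arr v y}.Subsingleton ∧ {y | G.Arr y v}.Subsingleton ∧
  ∀ x y, G.Arr x v → G.Arr v y → G.Rel x v y

/-- A permitted thread: a maximal permitted path, or a trivial permitted thread `[v]`. -/
def PermThread (l : List V) : Prop :=
  (G.PermPath l ∧ (∀ w, ¬ G.PermPath (l ++ [w])) ∧ ∀ w, ¬ G.PermPath (w :: l)) ∨
  ∃ v, l = [v] ∧ G.TrivPermVtx v

/-- A forbidden thread: a maximal forbidden path, or a trivial forbidden thread `[v]`. -/
def ForbThread (l : List V) : Prop :=
  (G.ForbPath l ∧ (∀ w, ¬ G.ForbPath (l ++ [w])) ∧ ∀ w, ¬ G.ForbPath (w :: l)) ∨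
  ∃ v, l = [v] ∧ G.TrivForbVtx v

end GPair

/-- A thread is closed if it is a cycle. -/
def IsClosedList {V : Type} (l : List V) : Prop := 2 ≤ l.length ∧ l.head? = l.getLast?

/-- The length (number of arrows) of a thread. -/
def threadLen {V : Type} (l : List V) : ℕ := l.length - 1

/-- Number of occurrences of the vertex `v` along the thread `l`. -/
def occ {V : Type} [DecidableEq V] (l : List V) (v : V) : ℕ :=
  if 2 ≤ l.length ∧ l.head? = l.getLast? then l.dropLast.count v else l.count v

/-- Arrow of the tiling quiver arising from the tile `T`. -/
def QArrIn (S : Set (Sym2 (ZMod M))) (T : Set (ZMod M)) (α β : Sym2 (ZMod M)) : Prop :=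
  IsTile S T ∧ IsBounding S T α ∧ IsBounding S T β ∧
  ∃ x a b : ZMod M, α = s(x, a) ∧ β = s(x, b) ∧ cnt x a < cnt x b

def QArr (S : Set (Sym2 (ZMod M))) (α β : Sym2 (ZMod M)) : Prop := ∃ T, QArrIn S T α β

def QRel (S : Set (Sym2 (ZMod M))) (α β γ : Sym2 (ZMod M)) : Prop :=
  ∃ T, QArrIn S T α β ∧ QArrIn S T β γ

/-- The tiling-algebra pair `(Q_S, R_S)` of a tiling `S`. -/
def tilingPair (S : Set (Sym2 (ZMod M))) : GPair {d : Sym2 (ZMod M) // d ∈ S} where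
  Arr := fun α β => QArr S α.1 β.1
  Rel := fun α β γ => QRel S α.1 β.1 γ.1

/-- Isomorphism of pairs. -/
def GPair.Iso {V W : Type} (G : GPair V) (H : GPair W) : Prop :=
  ∃ e : V ≃ W, (∀ x y, G.Arr x y ↔ H.Arr (e x) (e y)) ∧
    ∀ x y z, G.Rel x y z ↔ H.Rel (e x) (e y) (e z)

/-- `l` is the fan at the marked point `v`: the list of all diagonals of `S` incident with
`v`, in clockwise order around `v`. -/
def IsFan (S : Set (Sym2 (ZMod M))) (v : ZMod M) (l : List {d : Sym2 (ZMod M) // d ∈ S}) :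
    Prop :=
  l.Nodup ∧ (∀ d : {d : Sym2 (ZMod M) // d ∈ S}, d ∈ l ↔ v ∈ d.1) ∧
  l.Pairwise fun d e => ∃ a b : ZMod M, d.1 = s(v, a) ∧ e.1 = s(v, b) ∧ cnt v a < cnt v b

/-- `F` is the forbidden thread ending at `t(H)` from the opposite direction to `H`. -/
def OppEnd {V : Type} (G : GPair V) (H F : List V) : Prop :=
  ∃ y : V, H.getLast? = some y ∧ F.getLast? = some y ∧
    ((∃ x w, [x, y] <:+ H ∧ [w, y] <:+ F ∧ x ≠ w) ∨
     (∃ w, [w, y] <:+ F ∧ (∀ u, G.Arr u y → u = w) ∧ ¬ ([w, y] <:+: H)) ∨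
     (F = [y] ∧ {u | G.Arr u y}.Subsingleton ∧ ∀ u, G.Arr u y → [u, y] <:+: H))

/-- `H` is the permitted thread starting at `s(F)` in the opposite direction to `F`. -/
def OppStart {V : Type} (G : GPair V) (F H : List V) : Prop :=
  ∃ y : V, F.head? = some y ∧ H.head? = some y ∧
    ((∃ x w, [y, x] <+: F ∧ [y, w] <+: H ∧ x ≠ w) ∨
     (∃ w, [y, w] <+: H ∧ (∀ u, G.Arr y u → u = w) ∧ ¬ ([y, w] <:+: F)) ∨
     (H = [y] ∧ {u | G.Arr y u}.Subsingleton ∧ ∀ u, G.Arr y u → [y, u] <:+: F))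

/-- The AG-successor relation on permitted threads. -/
def AGStep {V : Type} (G : GPair V) (H H' : List V) : Prop :=
  ∃ F, G.ForbThread F ∧ OppEnd G H F ∧ OppStart G F H'

/-- The sides of a tile: bounding diagonals together with boundary edges. -/
def sides (S : Set (Sym2 (ZMod M))) (T : Set (ZMod M)) : Set (Sym2 (ZMod M)) :=
  {d | IsBounding S T d} ∪ {d | ∃ v : ZMod M, d = s(v, v + 1) ∧ v ∈ T ∧ (v + 1) ∈ T}

/-- An `(m+3)`-angulation of a disc. -/
def IsAngulation (m : ℕ) (S : Set (Sym2 (ZMod M))) : Prop :=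
  IsTiling S ∧ (∀ v : ZMod M, s(v, v + 1) ∉ S) ∧
  ∀ T, IsTile S T → (sides S T).ncard = m + 3

theorem val_sub_cases (N : ℕ) [NeZero N] (u v : ZMod N) :
    (v.val ≤ u.val ∧ (u - v).val = u.val - v.val) ∨
    (u.val < v.val ∧ (u - v).val = u.val + N - v.val) := by
  have hu := ZMod.val_lt u
  have hv := ZMod.val_lt v
  have hw := ZMod.val_lt (u - v)
  have h : ((u - v) + v).val = ((u - v).val + v.val) % N := ZMod.val_add _ _
  rw [sub_add_cancel] at h
  rcases lt_or_ge ((u - v).val + v.val) N with h1 | h1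
  · rw [Nat.mod_eq_of_lt h1] at h
    left; omega
  · rw [Nat.mod_eq_sub_mod h1, Nat.mod_eq_of_lt (by omega)] at h
    right; omega

theorem cw_iff (N : ℕ) [NeZero N] (a b c d : ZMod N) :
    CW [a, b, c, d] ↔
      0 < (b - a).val ∧ (b - a).val < (c - a).val ∧ (c - a).val < (d - a).val := by
  have h1 := val_sub_cases N (c - a) (b - a)
  have h2 := val_sub_cases N (d - a) (c - a)
  have h3 := val_sub_cases N (a - a) (d - a)
  rw [sub_sub_sub_cancel_right] at h1 h2 h3
  have hb := ZMod.val_lt (b - a)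
  have hc := ZMod.val_lt (c - a)
  have hd := ZMod.val_lt (d - a)
  have hz : (a - a).val = 0 := by simp
  have e1 : a = b → (b - a).val = 0 := by rintro rfl; simp
  have e2 : a = c → (c - a).val = 0 := by rintro rfl; simp
  have e3 : a = d → (d - a).val = 0 := by rintro rfl; simp
  have e4 : b = c → (b - a).val = (c - a).val := by rintro rfl; rfl
  have e5 : b = d → (b - a).val = (d - a).val := by rintro rfl; rfl
  have e6 : c = d → (c - a).val = (d - a).val := by rintro rfl; rfl
  have f1 : (b - a).val = 0 → a = b := by
    intro h; rw [ZMod.val_eq_zero, sub_eq_zero] at h; exact h.symm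
  have f4 : (b - a).val = (c - a).val → b = c := fun h => by
    simpa using ZMod.val_injective N h
  have f6 : (c - a).val = (d - a).val → c = d := fun h => by
    simpa using ZMod.val_injective N h
  have key : CW [a, b, c, d] ↔ ((a ≠ b ∧ a ≠ c ∧ a ≠ d) ∧ (b ≠ c ∧ b ≠ d) ∧ c ≠ d) ∧
      (b - a).val + ((c - b).val + ((d - c).val + (a - d).val)) = N := by
    simp [CW, List.rotate]
  rw [key]
  constructor
  · rintro ⟨⟨⟨n1, n2, n3⟩, ⟨n4, n5⟩, n6⟩, hs⟩
    have g1 : (b - a).val ≠ 0 := fun h => n1 (f1 h)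
    have g4 : (b - a).val ≠ (c - a).val := fun h => n4 (f4 h)
    have g3 : (d - a).val ≠ 0 := fun h => n3 (by
      rw [ZMod.val_eq_zero, sub_eq_zero] at h; exact h.symm)
    have g6 : (c - a).val ≠ (d - a).val := fun h => n6 (f6 h)
    omega
  · rintro ⟨l1, l2, l3⟩
    refine ⟨⟨⟨fun h => ?_, fun h => ?_, fun h => ?_⟩, ⟨fun h => ?_, fun h => ?_⟩, fun h => ?_⟩, ?_⟩
    · have := e1 h; omega
    · have := e2 h; omega
    · have := e3 h; omega
    · have := e4 h; omega
    · have := e5 h; omega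
    · have := e6 h; omega
    · omega

theorem cw_rot2 (N : ℕ) [NeZero N] (a b c d : ZMod N) (h : CW [a, b, c, d]) :
    CW [c, d, a, b] := by
  obtain ⟨h1, h2⟩ := h
  refine ⟨(List.Perm.nodup_iff (by simpa using List.perm_append_comm (l₁ := [a, b]) (l₂ := [c, d]))).1 h1, ?_⟩
  simp [List.rotate] at h2 ⊢
  omega

theorem crosses_iff (N : ℕ) [NeZero N] (a1 a2 b1 b2 : ZMod N) :
    Crosses s(a1, a2) s(b1, b2) ↔ CW [a1, b1, a2, b2] ∨ CW [a1, b2, a2, b1] := by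
  constructor
  · rintro ⟨p, q, r, s, h1, h2, h3⟩
    rw [Sym2.eq_iff] at h1 h2
    rcases h1 with ⟨rfl, rfl⟩ | ⟨rfl, rfl⟩ <;> rcases h2 with ⟨rfl, rfl⟩ | ⟨rfl, rfl⟩
    · exact Or.inl h3
    · exact Or.inr h3
    · exact Or.inr (cw_rot2 N _ _ _ _ h3)
    · exact Or.inl (cw_rot2 N _ _ _ _ h3)
  · rintro (h | h)
    · exact ⟨_, _, _, _, rfl, rfl, h⟩
    · exact ⟨_, _, _, _, rfl, Sym2.eq_swap, h⟩

theorem neighbour_shift_aux (m n N : ℕ) (hn : 2 ≤ n)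
    (hN : N = (m + 1) * (n + 1) - 2) (k : ℕ) (hk2 : 2 ≤ k) (hkm : k ≤ m)
    (a1 a2 : ZMod N) (b : Sym2 (ZMod N))
    (ha : IsMDiag m s(a1, a2)) (hb : IsMDiag m b)
    (hnb : Nbr 1 (shiftD (k - 1) s(a1, a2)) b)
    (hend : (a1 + (k : ZMod N)) ∈ b) :
    Nbr k s(a1, a2) b := by
  have hNm : 3 * m + 1 ≤ N := by
    have : (m + 1) * 3 ≤ (m + 1) * (n + 1) := Nat.mul_le_mul_left _ (by omega)
    omega
  have : NeZero N := ⟨by omega⟩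
  have : Fact (1 < N) := ⟨by omega⟩
  obtain ⟨y, rfl⟩ := hend
  obtain ⟨-, hncr, -⟩ := hnb
  set x := a1 + (k : ZMod N) with hx
  have hd1 := ha.2 a1 a2 rfl
  have he1 := hb.2 x y rfl
  have he2 := hb.2 y x Sym2.eq_swap
  have hxy : x ≠ y := fun h => hb.1 (by simpa using h)
  unfold cnt at hd1 he1 he2
  have hsy := val_sub_cases N (x - x) (y - x)
  rw [sub_sub_sub_cancel_right] at hsy
  have hz : (x - x).val = 0 := by simp
  have he0 : (y - x).val ≠ 0 := fun h => by
    rw [ZMod.val_eq_zero, sub_eq_zero] at h; exact hxy h.symm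
  have l1 := Nat.le_of_dvd (by omega) he1
  have l2 := Nat.le_of_dvd (by omega) he2
  have hdl := ZMod.val_lt (a2 - a1)
  have hel := ZMod.val_lt (y - x)
  have hkc : ((k - 1 : ℕ) : ZMod N) + 1 = (k : ZMod N) := by
    have : k - 1 + 1 = k := by omega
    exact_mod_cast congrArg (Nat.cast : ℕ → ZMod N) this
  have hxk : (x - a1).val = k := by
    rw [hx, add_sub_cancel_left, ZMod.val_natCast_of_lt (by omega)]
  have c1 : (a2 + ((k - 1 : ℕ) : ZMod N)) - (a1 + ((k - 1 : ℕ) : ZMod N)) = a2 - a1 := by ring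
  have c2 : x - (a1 + ((k - 1 : ℕ) : ZMod N)) = 1 := by rw [hx, ← hkc]; ring
  have c3 : y - (a1 + ((k - 1 : ℕ) : ZMod N)) = 1 + (y - x) := by rw [hx, ← hkc]; ring
  have v1 : (1 : ZMod N).val = 1 := ZMod.val_one N
  have v3 : (1 + (y - x)).val = 1 + (y - x).val := by
    rw [ZMod.val_add_of_lt (by omega), v1]
  have c4 : y - a1 = (x - a1) + (y - x) := by ring
  have hlt : (y - x).val + 1 ≤ (a2 - a1).val ∨ (a2 - a1).val ≤ 1 := by
    by_contra hcon
    apply hncr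
    have : shiftD (k - 1) s(a1, a2) =
      s(a1 + ((k - 1 : ℕ) : ZMod N), a2 + ((k - 1 : ℕ) : ZMod N)) := rfl
    rw [this, crosses_iff, cw_iff, c1, c2, c3, v1, v3]
    left; omega
  have hda : (a2 - a1).val ≠ 0 := fun h => by
    rw [ZMod.val_eq_zero, sub_eq_zero] at h
    exact ha.1 (by simpa using h.symm)
  have l3 := Nat.le_of_dvd (by omega) hd1
  have hlt' : (y - x).val + 1 ≤ (a2 - a1).val := by omega
  have hlt2 : (y - x).val + 1 + (m + 1) ≤ (a2 - a1).val + 1 := by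
    have := Nat.le_of_dvd (by omega) (Nat.dvd_sub hd1 he1)
    omega
  have v4 : (y - a1).val = k + (y - x).val := by
    rw [c4, ZMod.val_add_of_lt (by omega), hxk]
  refine ⟨fun h => ?_, fun h => ?_, a1, by simp, Or.inl (by rw [← hx]; simp)⟩
  · rw [Sym2.eq_iff] at h
    rcases h with ⟨h, -⟩ | ⟨-, h⟩
    · rw [← h] at hxk; simp at hxk; omega
    · rw [h] at hlt2; omega
  · rw [crosses_iff, cw_iff, cw_iff] at h
    omega

/-- Let `2 ≤ k ≤ m` and let `a = {a₁,a₂}` and `b` be `(m+1)`-diagonals of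
`P_{n,m}`.  If `b` is a `1`-neighbour of `Σ^{k-1} a` having `a₁+k` or `a₂+k` as an endpoint,
then `b` is a `k`-neighbour of `a`. -/
theorem neighbour_shift (m n N : ℕ) (hm : 1 ≤ m) (hn : 2 ≤ n) (hN : N = (m + 1) * (n + 1) - 2)
    (k : ℕ) (hk2 : 2 ≤ k) (hkm : k ≤ m)
    (a1 a2 : ZMod N) (b : Sym2 (ZMod N))
    (ha : IsMDiag m s(a1, a2)) (hb : IsMDiag m b)
    (hnb : Nbr 1 (shiftD (k - 1) s(a1, a2)) b)
    (hend : (a1 + (k : ZMod N)) ∈ b ∨ (a2 + (k : ZMod N)) ∈ b) :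
    Nbr k s(a1, a2) b := by
  rcases hend with hend | hend
  · exact neighbour_shift_aux m n N hn hN k hk2 hkm a1 a2 b ha hb hnb hend
  · rw [Sym2.eq_swap] at ha hnb ⊢
    exact neighbour_shift_aux m n N hn hN k hk2 hkm a2 a1 b ha hb hnb hend
end PaperTiling
end

section
/- Let 2 ≤ k ≤ m and let a = {a_1,a_2} and b = {b_1,b_2} be (m+1)-diagonals of P_{n,m}. Then b crosses Σ^{k−1}a with C(a_1+k−1, b_1, a_2+k−1, b_2) and [a_i+k−1, b_i] = x_i(m+1)+1 for some integers x_i ≥ 1 (i = 1,2) if and only if b crosses a with C(a_1, b_1, a_2, b_2) and [a_i, b_i] = y_i(m+1)+k for some integers y_i ≥ 1 (i = 1,2). -/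
namespace PaperTiling

variable {M : ℕ}

theorem val_of_cast {N : ℕ} [NeZero N] (x : ZMod N) (t : ℕ) (ht : t < N)
    (h : x = (t : ZMod N)) : x.val = t := by
  rw [h, ZMod.val_cast_of_lt ht]

theorem cw_four {N : ℕ} [NeZero N] (w x y z : ZMod N) :
    CW [w, x, y, z] ↔ (0 < (x - w).val ∧ 0 < (y - x).val ∧ 0 < (z - y).val ∧ 0 < (w - z).val ∧
      (x - w).val + (y - x).val + (z - y).val + (w - z).val = N) := by
  have key : ∀ u v : ZMod N, 0 < (v - u).val ↔ u ≠ v := by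
    intro u v
    rw [Nat.pos_iff_ne_zero, Ne, ZMod.val_eq_zero, sub_eq_zero, eq_comm]
  have hsum : ((([w, x, y, z] : List (ZMod N)).zip (([w, x, y, z] : List (ZMod N)).rotate 1)).map
      fun p => (p.2 - p.1).val).sum
      = (x - w).val + (y - x).val + (z - y).val + (w - z).val := by
    simp [add_assoc]
  unfold CW
  rw [hsum]
  constructor
  · rintro ⟨hn, hs⟩
    simp only [List.nodup_cons, List.mem_cons, List.not_mem_nil, or_false, not_or] at hn
    refine ⟨(key _ _).2 hn.1.1, (key _ _).2 hn.2.1.1, (key _ _).2 hn.2.2.1,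
      (key _ _).2 (Ne.symm hn.1.2.2), hs⟩
  · rintro ⟨h1, h2, h3, h4, hs⟩
    refine ⟨?_, hs⟩
    have e1 : (y - w).val = (x - w).val + (y - x).val := by
      apply val_of_cast _ _ (by omega)
      push_cast [ZMod.natCast_zmod_val]
      ring
    have e2 : (z - x).val = (y - x).val + (z - y).val := by
      apply val_of_cast _ _ (by omega)
      push_cast [ZMod.natCast_zmod_val]
      ring
    have n1 : w ≠ y := (key _ _).1 (by omega)
    have n2 : x ≠ z := (key _ _).1 (by omega)
    have n3 := (key _ _).1 h1
    have n4 := (key _ _).1 h2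
    have n5 := (key _ _).1 h3
    have n6 := ((key _ _).1 h4).symm
    simp [n1, n2, n3, n4, n5, n6]

/-- For `2 ≤ k ≤ m` and `(m+1)`-diagonals `a = {a₁,a₂}`, `b = {b₁,b₂}`
of `P_{n,m}`:  `b` crosses `Σ^{k-1} a` with `C(a₁+k-1, b₁, a₂+k-1, b₂)` and
`[aᵢ+k-1, bᵢ] = xᵢ(m+1)+1` for some `xᵢ ≥ 1` if and only if `b` crosses `a` with
`C(a₁, b₁, a₂, b₂)` and `[aᵢ, bᵢ] = yᵢ(m+1)+k` for some `yᵢ ≥ 1`. -/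
theorem crossing_shift (m n N : ℕ) (hm : 1 ≤ m) (hn : 2 ≤ n) (hN : N = (m + 1) * (n + 1) - 2)
    (k : ℕ) (hk2 : 2 ≤ k) (hkm : k ≤ m)
    (a1 a2 b1 b2 : ZMod N)
    (ha : IsMDiag m s(a1, a2)) (hb : IsMDiag m s(b1, b2)) :
    (CW [a1 + ((k - 1 : ℕ) : ZMod N), b1, a2 + ((k - 1 : ℕ) : ZMod N), b2] ∧
      (∃ x : ℕ, 1 ≤ x ∧ cnt (a1 + ((k - 1 : ℕ) : ZMod N)) b1 = x * (m + 1) + 1) ∧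
      (∃ x : ℕ, 1 ≤ x ∧ cnt (a2 + ((k - 1 : ℕ) : ZMod N)) b2 = x * (m + 1) + 1)) ↔
    (CW [a1, b1, a2, b2] ∧
      (∃ y : ℕ, 1 ≤ y ∧ cnt a1 b1 = y * (m + 1) + k) ∧
      (∃ y : ℕ, 1 ≤ y ∧ cnt a2 b2 = y * (m + 1) + k)) := by
  have hN3 : m + 1 + 2 ≤ N + 1 := by
    have : (m + 1) * 3 ≤ (m + 1) * (n + 1) := Nat.mul_le_mul_left _ (by omega)
    omega
  have : NeZero N := ⟨by omega⟩
  obtain ⟨c, rfl⟩ : ∃ c, k = c + 1 := ⟨k - 1, by omega⟩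
  simp only [Nat.add_sub_cancel]
  rw [cw_four, cw_four]
  simp only [cnt]
  constructor
  · rintro ⟨⟨h1, h2, h3, h4, hs⟩, ⟨x1, hx1, e1⟩, ⟨x2, hx2, e2⟩⟩
    have d1 := ha.2 a1 a2 rfl
    have d2 := ha.2 a2 a1 Sym2.eq_swap
    simp only [cnt] at d1 d2
    have f1 : (a2 - a1).val = (b1 - (a1 + (c : ZMod N))).val + (a2 + (c : ZMod N) - b1).val := by
      apply val_of_cast _ _ (by omega)
      push_cast [ZMod.natCast_zmod_val]
      ring
    have f2 : (a1 - a2).val = (b2 - (a2 + (c : ZMod N))).val + (a1 + (c : ZMod N) - b2).val := by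
      apply val_of_cast _ _ (by omega)
      push_cast [ZMod.natCast_zmod_val]
      ring
    have g1 : (m + 1) ∣ (a2 + (c : ZMod N) - b1).val + 1 := by
      have : (a2 - a1).val + 1 = x1 * (m + 1) + ((a2 + (c : ZMod N) - b1).val + 1) := by omega
      rw [this] at d1
      exact (Nat.dvd_add_right (Dvd.intro_left _ rfl)).1 d1
    have g2 : (m + 1) ∣ (a1 + (c : ZMod N) - b2).val + 1 := by
      have : (a1 - a2).val + 1 = x2 * (m + 1) + ((a1 + (c : ZMod N) - b2).val + 1) := by omega
      rw [this] at d2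
      exact (Nat.dvd_add_right (Dvd.intro_left _ rfl)).1 d2
    have l1 := Nat.le_of_dvd (by omega) g1
    have l2 := Nat.le_of_dvd (by omega) g2
    have v1 : (b1 - a1).val = (b1 - (a1 + (c : ZMod N))).val + c := by
      apply val_of_cast _ _ (by omega)
      push_cast [ZMod.natCast_zmod_val]
      ring
    have v2 : (b2 - a2).val = (b2 - (a2 + (c : ZMod N))).val + c := by
      apply val_of_cast _ _ (by omega)
      push_cast [ZMod.natCast_zmod_val]
      ring
    have v3 : (a2 - b1).val = (a2 + (c : ZMod N) - b1).val - c := by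
      apply val_of_cast _ _ (by omega)
      rw [Nat.cast_sub (by omega), ZMod.natCast_zmod_val]
      ring
    have v4 : (a1 - b2).val = (a1 + (c : ZMod N) - b2).val - c := by
      apply val_of_cast _ _ (by omega)
      rw [Nat.cast_sub (by omega), ZMod.natCast_zmod_val]
      ring
    exact ⟨by omega, ⟨x1, hx1, by omega⟩, ⟨x2, hx2, by omega⟩⟩
  · rintro ⟨⟨h1, h2, h3, h4, hs⟩, ⟨x1, hx1, e1⟩, ⟨x2, hx2, e2⟩⟩
    have p1 : m + 1 ≤ x1 * (m + 1) := Nat.le_mul_of_pos_left _ hx1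
    have p2 : m + 1 ≤ x2 * (m + 1) := Nat.le_mul_of_pos_left _ hx2
    have v1 : (b1 - (a1 + (c : ZMod N))).val = (b1 - a1).val - c := by
      apply val_of_cast _ _ (by omega)
      rw [Nat.cast_sub (by omega), ZMod.natCast_zmod_val]
      ring
    have v2 : (b2 - (a2 + (c : ZMod N))).val = (b2 - a2).val - c := by
      apply val_of_cast _ _ (by omega)
      rw [Nat.cast_sub (by omega), ZMod.natCast_zmod_val]
      ring
    have v3 : (a2 + (c : ZMod N) - b1).val = (a2 - b1).val + c := by
      apply val_of_cast _ _ (by omega)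
      push_cast [ZMod.natCast_zmod_val]
      ring
    have v4 : (a1 + (c : ZMod N) - b2).val = (a1 - b2).val + c := by
      apply val_of_cast _ _ (by omega)
      push_cast [ZMod.natCast_zmod_val]
      ring
    exact ⟨by omega, ⟨x1, hx1, by omega⟩, ⟨x2, hx2, by omega⟩⟩
end PaperTiling
end

section
/- A set S of (m+1)-diagonals of P_{n,m} is m-rigid if and only if the following three conditions hold: (1) no two distinct diagonals of S are k-neighbours, for every k ∈ {1,…,m}; (2) no two distinct short diagonals of S share an endpoint; (3) whenever two distinct diagonals of S cross, one of them is short and the other is long. -/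
namespace PaperTiling

variable {M : ℕ}

/-- Unfolded form of `CW` for four vertices. -/
theorem cw4_iff {M : ℕ} (a b c d : ZMod M) : CW [a, b, c, d] ↔
    (a ≠ b ∧ a ≠ c ∧ a ≠ d ∧ b ≠ c ∧ b ≠ d ∧ c ≠ d) ∧
      (b - a).val + (c - b).val + (d - c).val + (a - d).val = M := by
  simp [CW, List.rotate]
  constructor
  · rintro ⟨h1, h2⟩
    refine ⟨by tauto, by omega⟩
  · rintro ⟨h1, h2⟩
    refine ⟨by tauto, by omega⟩

theorem cw4_rotate {M : ℕ} {a b c d : ZMod M} (h : CW [a, b, c, d]) : CW [b, c, d, a] := by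
  rw [cw4_iff] at h ⊢
  obtain ⟨⟨h1, h2, h3, h4, h5, h6⟩, h⟩ := h
  exact ⟨⟨h4, h5, h1.symm, h6, h2.symm, h3.symm⟩, by omega⟩

theorem crosses_symm {M : ℕ} {d e : Sym2 (ZMod M)} (h : Crosses d e) : Crosses e d := by
  obtain ⟨a1, b1, a2, b2, rfl, rfl, h⟩ := h
  exact ⟨b1, a2, b2, a1, rfl, Sym2.eq_swap, cw4_rotate h⟩

theorem val_sub_pos {M : ℕ} [NeZero M] {a b : ZMod M} (h : a ≠ b) : 1 ≤ (b - a).val := by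
  rw [Nat.one_le_iff_ne_zero, Ne, ZMod.val_eq_zero, sub_eq_zero]
  exact fun h' => h h'.symm

theorem val_sub_add {M : ℕ} [NeZero M] {a b c : ZMod M}
    (h : (b - a).val + (c - b).val < M) : (c - a).val = (b - a).val + (c - b).val := by
  rw [← ZMod.val_add_of_lt h]
  congr 1
  ring

theorem eq_add_of_val {M : ℕ} [NeZero M] {a b : ZMod M} {k : ℕ} (h : (b - a).val = k) :
    b = a + (k : ZMod M) := by
  rw [← h, ZMod.natCast_zmod_val]
  ring

theorem isShort_iff {M m : ℕ} [NeZero M] (hm : m < M) (x y : ZMod M) :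
    IsShort m s(x, y) ↔ (y - x).val = m ∨ (x - y).val = m := by
  constructor
  · rintro ⟨v, hv⟩
    rw [Sym2.eq_iff] at hv
    rcases hv with ⟨rfl, rfl⟩ | ⟨rfl, rfl⟩
    · left
      rw [add_sub_cancel_left, ZMod.val_cast_of_lt hm]
    · right
      rw [add_sub_cancel_left, ZMod.val_cast_of_lt hm]
  · rintro (h | h)
    · exact ⟨x, by rw [← eq_add_of_val h]⟩
    · exact ⟨y, by rw [← eq_add_of_val h, Sym2.eq_swap]⟩

/-- The four gaps of a crossing. -/
theorem gaps {M : ℕ} [NeZero M] {a b c d : ZMod M} (h : CW [a, b, c, d]) :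
    1 ≤ (b - a).val ∧ 1 ≤ (c - b).val ∧ 1 ≤ (d - c).val ∧ 1 ≤ (a - d).val ∧
    (b - a).val + (c - b).val + (d - c).val + (a - d).val = M ∧
    (c - a).val = (b - a).val + (c - b).val ∧
    (d - b).val = (c - b).val + (d - c).val ∧
    (a - c).val = (d - c).val + (a - d).val ∧
    (b - d).val = (a - d).val + (b - a).val := by
  rw [cw4_iff] at h
  obtain ⟨⟨h1, h2, h3, h4, h5, h6⟩, h⟩ := h
  have p1 := val_sub_pos h1
  have p2 := val_sub_pos h4
  have p3 := val_sub_pos h6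
  have p4 := val_sub_pos h3.symm
  exact ⟨p1, p2, p3, p4, h, val_sub_add (by omega), val_sub_add (by omega),
    val_sub_add (by omega), val_sub_add (by omega)⟩

theorem dvd_small {c t : ℕ} (h : c ∣ t) (h0 : 0 < t) (h1 : t < 2 * c) : t = c := by
  obtain ⟨y, rfl⟩ := h
  rcases y with _ | _ | y
  · simp at h0
  · simp
  · nlinarith

/-- Arithmetic core: two crossing long diagonals. -/
theorem arith_core {m p q r s : ℕ} (hm : 1 ≤ m) (hp : 1 ≤ p) (hq : 1 ≤ q) (hr : 1 ≤ r)
    (hs : 1 ≤ s) (h1 : (m + 1) ∣ p + q + 1) (h2 : (m + 1) ∣ q + r + 1)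
    (h3 : (m + 1) ∣ r + s + 1) (h4 : (m + 1) ∣ s + p + 1)
    (n1 : p + q ≠ m) (n2 : q + r ≠ m) (n3 : r + s ≠ m) (n4 : s + p ≠ m) :
    ∃ k, 1 ≤ k ∧ k ≤ m ∧
      (((∃ x, 1 ≤ x ∧ p + 1 = x * (m + 1) + k) ∧ (∃ x, 1 ≤ x ∧ r + 1 = x * (m + 1) + k)) ∨
       ((∃ x, 1 ≤ x ∧ q + 1 = x * (m + 1) + k) ∧ (∃ x, 1 ≤ x ∧ s + 1 = x * (m + 1) + k))) := by
  have rep : ∀ {t k : ℕ}, t % (m + 1) = k → m + 1 ≤ t →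
      ∃ x, 1 ≤ x ∧ t = x * (m + 1) + k := by
    intro t k ht hle
    refine ⟨t / (m + 1), (Nat.one_le_div_iff (by omega)).2 hle, ?_⟩
    rw [← ht, mul_comm]
    exact (Nat.div_add_mod t (m + 1)).symm
  have epr : (p + 1) % (m + 1) = (r + 1) % (m + 1) := by
    have : (p + 1) ≡ (r + 1) [MOD (m + 1)] := by
      have e : q + (p + 1) ≡ q + (r + 1) [MOD (m + 1)] := by
        have e1 := (Nat.modEq_zero_iff_dvd.2 h1).trans (Nat.modEq_zero_iff_dvd.2 h2).symm
        have a1 : q + (p + 1) = p + q + 1 := by ring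
        have a2 : q + (r + 1) = q + r + 1 := by ring
        rwa [a1, a2]
      exact Nat.ModEq.add_left_cancel' q e
    exact this
  have eqs : (q + 1) % (m + 1) = (s + 1) % (m + 1) := by
    have : (q + 1) ≡ (s + 1) [MOD (m + 1)] := by
      have e : p + (q + 1) ≡ p + (s + 1) [MOD (m + 1)] := by
        have e1 := (Nat.modEq_zero_iff_dvd.2 h1).trans (Nat.modEq_zero_iff_dvd.2 h4).symm
        have a1 : p + (q + 1) = p + q + 1 := by ring
        have a2 : p + (s + 1) = s + p + 1 := by ring
        rwa [a1, a2]
      exact Nat.ModEq.add_left_cancel' p e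
    exact this
  by_cases A : (m + 1 ≤ p + 1 ∧ m + 1 ≤ r + 1) ∧ (p + 1) % (m + 1) ≠ 0
  · have := Nat.mod_lt (p + 1) (show 0 < m + 1 by omega)
    exact ⟨(p + 1) % (m + 1), by omega, by omega, Or.inl
      ⟨rep rfl A.1.1, rep epr.symm A.1.2⟩⟩
  by_cases B : (m + 1 ≤ q + 1 ∧ m + 1 ≤ s + 1) ∧ (q + 1) % (m + 1) ≠ 0
  · have := Nat.mod_lt (q + 1) (show 0 < m + 1 by omega)
    exact ⟨(q + 1) % (m + 1), by omega, by omega, Or.inr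
      ⟨rep rfl B.1.1, rep eqs.symm B.1.2⟩⟩
  exfalso
  -- no residue of a gap is zero together with a small partner, and two small
  -- neighbouring gaps give a short diagonal
  have small : ∀ {u v : ℕ}, (m + 1) ∣ u + v + 1 → u + v ≠ m → u < m → v < m → False := by
    intro u v hd hne hu hv
    have := dvd_small hd (by omega) (by omega)
    omega
  have zero : ∀ {u v : ℕ}, (m + 1) ∣ u + v + 1 → (m + 1) ∣ u + 1 → 1 ≤ v → m + 1 ≤ v := by
    intro u v hd hu hv
    have : (m + 1) ∣ v := by
      have e : u + v + 1 = (u + 1) + v := by ring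
      rw [e] at hd
      exact (Nat.dvd_add_right hu).1 hd
    exact Nat.le_of_dvd (by omega) this
  by_cases zp : (p + 1) % (m + 1) = 0
  · have dp := Nat.dvd_of_mod_eq_zero zp
    have dr := Nat.dvd_of_mod_eq_zero (epr ▸ zp)
    have z1 := zero h1 dp hq
    have z2 := zero h3 dr hs
    have zq : (q + 1) % (m + 1) = 0 := by
      by_contra hne
      exact B ⟨⟨by omega, by omega⟩, hne⟩
    have dq := Nat.dvd_of_mod_eq_zero zq
    have : (m + 1) ∣ p := by
      have e : p + q + 1 = (q + 1) + p := by ring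
      rw [e] at h1
      exact (Nat.dvd_add_right dq).1 h1
    have := (Nat.dvd_add_right this).1 dp
    have := Nat.le_of_dvd one_pos this
    omega
  · have A' : p < m ∨ r < m := by
      by_contra hh
      exact A ⟨⟨by omega, by omega⟩, zp⟩
    by_cases zq : (q + 1) % (m + 1) = 0
    · have dq := Nat.dvd_of_mod_eq_zero zq
      have z1 := zero (u := q) (v := p) (by rwa [add_comm q p]) dq hp
      have z2 := zero h2 dq hr
      omega
    · have B' : q < m ∨ s < m := by
        by_contra hh
        exact B ⟨⟨by omega, by omega⟩, zq⟩
      rcases A' with hA | hA <;> rcases B' with hB | hB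
      · exact small h1 n1 hA hB
      · exact small h4 n4 hB hA
      · exact small h2 n2 hB hA
      · exact small h3 n3 hA hB

theorem isShort_shift {M m k : ℕ} {d : Sym2 (ZMod M)} (h : IsShort m d) :
    IsShort m (shiftD k d) := by
  obtain ⟨v, rfl⟩ := h
  exact ⟨v + k, by simp only [shiftD, Sym2.map_mk]; rw [add_right_comm]⟩

theorem isShort_of_shift {M m k : ℕ} {d : Sym2 (ZMod M)} (h : IsShort m (shiftD k d)) :
    IsShort m d := by
  obtain ⟨v, hv⟩ := h
  refine ⟨v - k, ?_⟩
  apply_fun Sym2.map (fun w => w - (k : ZMod M)) at hv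
  simp only [shiftD, Sym2.map_map, Sym2.map_mk] at hv
  have e : ((fun w => w - (k : ZMod M)) ∘ fun v => v + (k : ZMod M)) = id := by
    funext w
    simp
  rw [e, Sym2.map_id, id] at hv
  rw [hv]
  congr 2
  ring

/-- A diagonal is never equal to its small shifts. -/
theorem shift_ne {M k : ℕ} [NeZero M] (h1 : 1 ≤ k) (h2 : 2 * k < M) (d : Sym2 (ZMod M)) :
    shiftD k d ≠ d := by
  have key : ∀ t : ℕ, 1 ≤ t → t < M → (t : ZMod M) ≠ 0 := by
    intro t ht htM h0
    rw [ZMod.natCast_eq_zero_iff] at h0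
    have := Nat.le_of_dvd (by omega) h0
    omega
  induction d using Sym2.ind with
  | _ x y =>
    intro h
    simp only [shiftD, Sym2.map_mk, Sym2.eq_iff] at h
    rcases h with ⟨hx, -⟩ | ⟨hx, hy⟩
    · exact key k h1 (by omega) (by simpa using hx)
    · apply key (2 * k) (by omega) h2
      rw [← hx] at hy
      push_cast
      linear_combination hy

/-- Proposition 2.1. A set `S` of `(m+1)`-diagonals of `P_{n,m}` is
`m`-rigid iff: (1) no two distinct diagonals of `S` are `k`-neighbours for `1 ≤ k ≤ m`;
(2) no two distinct short diagonals of `S` share an endpoint; (3) whenever two distinct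
diagonals of `S` cross, one is short and the other is long. -/
theorem mRigid_iff (m n N : ℕ) (hm : 1 ≤ m) (hn : 2 ≤ n) (hN : N = (m + 1) * (n + 1) - 2)
    (S : Set (Sym2 (ZMod N))) (hS : ∀ d ∈ S, IsMDiag m d) :
    MRigid m S ↔
      ((∀ a ∈ S, ∀ b ∈ S, ∀ k : ℕ, 1 ≤ k → k ≤ m → ¬ Nbr k a b) ∧
       (∀ a ∈ S, ∀ b ∈ S, IsShort m a → IsShort m b → a ≠ b →
         ∀ v : ZMod N, v ∈ a → v ∉ b) ∧
       (∀ a ∈ S, ∀ b ∈ S, a ≠ b → Crosses a b →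
         (IsShort m a ∧ IsLong m b) ∨ (IsLong m a ∧ IsShort m b))) := by
  have hbig : 3 * m + 1 ≤ N := by
    have : (m + 1) * 3 ≤ (m + 1) * (n + 1) := Nat.mul_le_mul_left _ (by omega)
    omega
  haveI : NeZero N := ⟨by omega⟩
  constructor
  · intro hR
    refine ⟨?_, ?_, ?_⟩
    · rintro a ha b hb k hk1 hk2 ⟨hne, hc, v, hv, h | h⟩
      · exact hR a ha b hb k hk1 hk2 (Or.inl ⟨⟨hne, hc, v, hv, Or.inl h⟩, v, hv, h⟩)
      · refine hR b hb a ha k hk1 hk2 (Or.inl ⟨⟨hne.symm, fun hh => hc (crosses_symm hh),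
          v - k, h, Or.inl ?_⟩, v - k, h, ?_⟩)
        · rwa [sub_add_cancel]
        · rwa [sub_add_cancel]
    · rintro a ha b hb ⟨v, rfl⟩ ⟨w, rfl⟩ hne u hu hu'
      rw [Sym2.mem_iff] at hu hu'
      rcases hu with rfl | rfl <;> rcases hu' with h | h
      · exact hne (by rw [h])
      · refine hR _ hb _ ha m hm le_rfl (Or.inr (Or.inr ?_))
        rw [h]
        rfl
      · refine hR _ ha _ hb m hm le_rfl (Or.inr (Or.inr ?_))
        rw [← h]
        rfl
      · exact hne (by rw [add_right_cancel h])
    · rintro a ha b hb hne ⟨a1, b1, a2, b2, rfl, rfl, hcw⟩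
      have hda := hS _ ha
      have hdb := hS _ hb
      obtain ⟨p1, p2, p3, p4, hsum, e1, e2, e3, e4⟩ := gaps hcw
      have sa := isShort_iff (m := m) (by omega) a1 a2
      have sb := isShort_iff (m := m) (by omega) b1 b2
      by_cases hsa : IsShort m s(a1, a2) <;> by_cases hsb : IsShort m s(b1, b2)
      · exfalso
        have hA := sa.1 hsa
        have hB := sb.1 hsb
        have alt : ((b1 - a1).val = (b2 - a2).val ∧ (b1 - a1).val ≤ m) ∨
            ((a2 - b1).val = (a1 - b2).val ∧ (a2 - b1).val ≤ m) := by omega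
        rcases alt with ⟨hh, hle⟩ | ⟨hh, hle⟩
        · refine hR _ ha _ hb _ p1 hle (Or.inr (Or.inr ?_))
          simp only [shiftD, Sym2.map_mk]
          rw [← eq_add_of_val (rfl : (b1 - a1).val = _), ← eq_add_of_val hh.symm]
        · refine hR _ hb _ ha _ p2 hle (Or.inr (Or.inr ?_))
          simp only [shiftD, Sym2.map_mk]
          rw [← eq_add_of_val (rfl : (a2 - b1).val = _), ← eq_add_of_val hh.symm,
            Sym2.eq_swap]
      · exact Or.inl ⟨hsa, hdb, hsb⟩
      · exact Or.inr ⟨⟨hda, hsa⟩, hsb⟩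
      · exfalso
        rw [sa] at hsa
        rw [sb] at hsb
        push Not at hsa hsb
        have d1 := hda.2 a1 a2 rfl
        have d2 := hdb.2 b1 b2 rfl
        have d3 := hda.2 a2 a1 Sym2.eq_swap
        have d4 := hdb.2 b2 b1 Sym2.eq_swap
        rw [cnt, e1] at d1
        rw [cnt, e2] at d2
        rw [cnt, e3] at d3
        rw [cnt, e4] at d4
        obtain ⟨k, hk1, hk2, ⟨hx, hy⟩ | ⟨hx, hy⟩⟩ := arith_core hm p1 p2 p3 p4 d1 d2 d3 d4
          (by omega) (by omega) (by omega) (by omega)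
        · exact hR _ ha _ hb k hk1 hk2 (Or.inr (Or.inl
            ⟨a1, b1, a2, b2, rfl, rfl, hcw, hx, hy⟩))
        · exact hR _ hb _ ha k hk1 hk2 (Or.inr (Or.inl
            ⟨b1, a2, b2, a1, rfl, Sym2.eq_swap, cw4_rotate hcw, hx, hy⟩))
  · rintro ⟨h1, -, h3⟩ a ha b hb k hk1 hk2 (⟨hn, -⟩ | hc | hsh)
    · exact h1 a ha b hb k hk1 hk2 hn
    · obtain ⟨a1, b1, a2, b2, rfl, rfl, hcw, ⟨x, hx, hx'⟩, ⟨y, hy, hy'⟩⟩ := hc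
      obtain ⟨p1, p2, p3, p4, hsum, e1, e2, e3, e4⟩ := gaps hcw
      have hne : s(a1, a2) ≠ s(b1, b2) := by
        have hd := ((cw4_iff _ _ _ _).1 hcw).1
        rw [Ne, Sym2.eq_iff]
        tauto
      have sa := isShort_iff (m := m) (by omega) a1 a2
      have sb := isShort_iff (m := m) (by omega) b1 b2
      have gx : m + 1 ≤ x * (m + 1) := Nat.le_mul_of_pos_left _ hx
      have gy : m + 1 ≤ y * (m + 1) := Nat.le_mul_of_pos_left _ hy
      rw [cnt] at hx' hy'
      rcases h3 _ ha _ hb hne ⟨a1, b1, a2, b2, rfl, rfl, hcw⟩ with ⟨h, -⟩ | ⟨-, h⟩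
      · have := sa.1 h
        omega
      · have := sb.1 h
        omega
    · subst hsh
      have hne : a ≠ shiftD k a := (shift_ne hk1 (by omega) a).symm
      by_cases hcr : Crosses a (shiftD k a)
      · rcases h3 _ ha _ hb hne hcr with ⟨h, hl⟩ | ⟨hl, h⟩
        · exact hl.2 (isShort_shift h)
        · exact hl.2 (isShort_of_shift h)
      · refine h1 _ ha _ hb k hk1 hk2 ⟨hne, hcr, ?_⟩
        induction a using Sym2.ind with
        | _ u w =>
          exact ⟨u, Sym2.mem_mk_left u w, Or.inl (by simp [shiftD])⟩

end PaperTiling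
end

section
/- Let S be a maximal m-rigid set of (m+1)-diagonals of P_{n,m}. If some two distinct diagonals of S cross, then the induced subgraph of the graph of S on its non-isolated vertices is disconnected. -/
namespace PaperTiling

variable {M : ℕ}

/-- The data of a crossing in terms of natural-number gaps. -/
lemma cw_four_s4 [NeZero M] {a b c d : ZMod M} (h : CW [a, b, c, d]) :
    (1 ≤ (b - a).val ∧ 1 ≤ (c - b).val ∧ 1 ≤ (d - c).val ∧ 1 ≤ (a - d).val) ∧
    (b - a).val + (c - b).val + (d - c).val + (a - d).val = M := by
  obtain ⟨hn, hs⟩ := h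
  have pos : ∀ x y : ZMod M, x ≠ y → 1 ≤ (y - x).val := by
    intro x y hxy
    have : (y - x).val ≠ 0 := by
      rw [Ne, ZMod.val_eq_zero, sub_eq_zero]
      exact fun e => hxy e.symm
    omega
  simp at hn hs
  obtain ⟨⟨h1, h2, h3⟩, ⟨h4, h5⟩, h6⟩ := hn
  refine ⟨⟨pos _ _ h1, pos _ _ h4, pos _ _ h6, pos _ _ (Ne.symm h3)⟩, ?_⟩
  omega

lemma cw_rot {a b c d : ZMod M} (h : CW [a, b, c, d]) : CW [b, c, d, a] := by
  obtain ⟨hn, hs⟩ := h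
  simp at hn hs
  obtain ⟨⟨h1, h2, h3⟩, ⟨h4, h5⟩, h6⟩ := hn
  refine ⟨?_, ?_⟩
  · simp
    exact ⟨⟨h4, h5, Ne.symm h1⟩, ⟨h6, Ne.symm h2⟩, Ne.symm h3⟩
  · simp
    omega

/-- Gap addition along an arc. -/
lemma val_gap [NeZero M] (a b c : ZMod M) (h : (b - a).val + (c - b).val < M) :
    (c - a).val = (b - a).val + (c - b).val := by
  rw [← ZMod.val_add_of_lt h]
  congr 1
  ring

/-- A rigid crossing has one small gap, or gaps divisible by `m + 1`. -/
lemma cross_step [NeZero M] {m : ℕ} {a b c d : ZMod M}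
    (h : CW [a, b, c, d])
    (hr : (m + 1) ∣ (b - a).val + (c - b).val + 1)
    (hs : (m + 1) ∣ (c - b).val + (d - c).val + 1)
    (hE : ∀ k : ℕ, 1 ≤ k → k ≤ m → ¬ Ek m k s(b, d) s(a, c)) :
    (m + 1) ∣ (b - a).val + 1 ∨ (b - a).val + 1 ≤ m ∨ (d - c).val + 1 ≤ m := by
  by_contra hcon
  push Not at hcon
  obtain ⟨h0, h1, h2⟩ := hcon
  have hmod : ((b - a).val + 1) % (m + 1) = ((d - c).val + 1) % (m + 1) := by
    have e : (b - a).val + 1 + (c - b).val ≡ (d - c).val + 1 + (c - b).val [MOD (m + 1)] := by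
      have e1 := (Nat.modEq_zero_iff_dvd).2 hr
      have e2 := (Nat.modEq_zero_iff_dvd).2 hs
      have := e1.trans e2.symm
      convert this using 1 <;> ring
    exact Nat.ModEq.add_right_cancel' _ e
  have hk : ((b - a).val + 1) % (m + 1) ≠ 0 := fun e => h0 (Nat.dvd_of_mod_eq_zero e)
  have hlt : ((b - a).val + 1) % (m + 1) < m + 1 := Nat.mod_lt _ (Nat.succ_pos m)
  refine hE (((b - a).val + 1) % (m + 1)) (by omega) (by omega) ?_
  refine Or.inr (Or.inl ⟨a, b, c, d, rfl, rfl, h, ⟨((b - a).val + 1) / (m + 1), ?_, ?_⟩,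
    ⟨((d - c).val + 1) / (m + 1), ?_, ?_⟩⟩)
  · exact (Nat.one_le_div_iff (Nat.succ_pos m)).2 (by omega)
  · unfold cnt
    exact (Nat.div_add_mod' _ _).symm
  · exact (Nat.one_le_div_iff (Nat.succ_pos m)).2 (by omega)
  · unfold cnt
    rw [hmod]
    exact (Nat.div_add_mod' _ _).symm

lemma dvd_small_s4 {m p q : ℕ} (h : (m + 1) ∣ p + q + 1) (hp : p + 1 ≤ m) (hq : q + 1 ≤ m) :
    p + q = m := by
  obtain ⟨x, hx⟩ := h
  have h1 : x = 1 := by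
    have : x < 2 := by
      by_contra hc
      have : (m + 1) * 2 ≤ (m + 1) * x := Nat.mul_le_mul_left _ (by omega)
      omega
    interval_cases x <;> omega
  subst h1
  omega

lemma short_of_gap [NeZero M] {m : ℕ} {a c : ZMod M} (h : (c - a).val = m) :
    IsShort m s(a, c) := by
  refine ⟨a, ?_⟩
  rw [← h, ZMod.natCast_zmod_val]
  simp

lemma dvd_next {m p q : ℕ} (hm : 1 ≤ m) (hq : 1 ≤ q) (h : (m + 1) ∣ p + q + 1)
    (hp : (m + 1) ∣ p + 1) : (m + 1) ∣ q := by
  have : p + q + 1 = (p + 1) + q := by ring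
  rw [this] at h
  exact (Nat.dvd_add_right hp).1 h

/-- In a rigid crossing, one of the two diagonals is short. -/
lemma short_of_cross [NeZero M] {m : ℕ} (hm : 1 ≤ m) {S : Set (Sym2 (ZMod M))}
    (hd : ∀ d ∈ S, IsMDiag m d) (hr : MRigid m S) {a b : Sym2 (ZMod M)} (ha : a ∈ S)
    (hb : b ∈ S) (hc : Crosses a b) : IsShort m a ∨ IsShort m b := by
  obtain ⟨a1, b1, a2, b2, rfl, rfl, h⟩ := hc
  obtain ⟨⟨p1, q1, r1, s1⟩, hsum⟩ := cw_four_s4 h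
  have v1 := val_gap a1 b1 a2 (by omega)
  have v2 := val_gap b1 a2 b2 (by omega)
  have v3 := val_gap a2 b2 a1 (by omega)
  have v4 := val_gap b2 a1 b1 (by omega)
  have d1 := (hd _ ha).2 a1 a2 rfl
  have d2 := (hd _ hb).2 b1 b2 rfl
  have d3 := (hd _ ha).2 a2 a1 Sym2.eq_swap
  have d4 := (hd _ hb).2 b2 b1 Sym2.eq_swap
  unfold cnt at d1 d2 d3 d4
  rw [v1] at d1
  rw [v2] at d2
  rw [v3] at d3
  rw [v4] at d4
  have c1 := cross_step h d1 d2 (hr _ ha _ hb)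
  have c2 := cross_step (cw_rot h) d2 d3 (by
    intro k hk1 hk2
    have := hr _ hb _ ha k hk1 hk2
    rwa [Sym2.eq_swap (a := a1)] at this)
  have d1' : (m + 1) ∣ (a2 - b1).val + (b1 - a1).val + 1 := by rwa [add_comm (a2 - b1).val]
  have d4' : (m + 1) ∣ (b1 - a1).val + (a1 - b2).val + 1 := by rwa [add_comm (b1 - a1).val]
  have d2' : (m + 1) ∣ (b2 - a2).val + (a2 - b1).val + 1 := by rwa [add_comm (b2 - a2).val]
  -- divisibility is impossible, as the next gap would be a multiple of `m + 1`
  have key1 : (b1 - a1).val + 1 ≤ m ∨ (b2 - a2).val + 1 ≤ m := by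
    rcases c1 with c | c
    · exfalso
      have q := dvd_next hm q1 d1 c
      have s := dvd_next hm s1 d4' c
      have := Nat.le_of_dvd q1 q
      have := Nat.le_of_dvd s1 s
      rcases c2 with c' | c'
      · have := (Nat.dvd_add_right q).1 c'
        have := Nat.le_of_dvd one_pos this
        omega
      · omega
    · exact c
  have key2 : (a2 - b1).val + 1 ≤ m ∨ (a1 - b2).val + 1 ≤ m := by
    rcases c2 with c | c
    · exfalso
      have p := dvd_next hm p1 d1' c
      have r := dvd_next hm r1 d2 c
      have := Nat.le_of_dvd p1 p
      have := Nat.le_of_dvd r1 r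
      omega
    · exact c
  rcases key1 with p | r <;> rcases key2 with q | s
  · exact Or.inl (short_of_gap (v1.trans (dvd_small_s4 d1 p q)))
  · exact Or.inr (Sym2.eq_swap (a := b2) ▸ short_of_gap (v4.trans (dvd_small_s4 d4 s p)))
  · exact Or.inr (short_of_gap (v2.trans (dvd_small_s4 d2 q r)))
  · exact Or.inl (Sym2.eq_swap (a := a2) ▸ short_of_gap (v3.trans (dvd_small_s4 d3 r s)))

lemma not_crosses_of_common {d e : Sym2 (ZMod M)} {v : ZMod M} (hd : v ∈ d) (he : v ∈ e) :
    ¬ Crosses d e := by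
  rintro ⟨a1, b1, a2, b2, rfl, rfl, hn, -⟩
  simp at hn hd he
  grind

/-- A short diagonal of a rigid set shares no endpoint with another one. -/
lemma short_disjoint {m : ℕ} (hm : 1 ≤ m) {S : Set (Sym2 (ZMod M))} (hr : MRigid m S)
    {a b : Sym2 (ZMod M)} (ha : a ∈ S) (hb : b ∈ S) (hs : IsShort m a) {w : ZMod M}
    (hwa : w ∈ a) (hwb : w ∈ b) : a = b := by
  by_contra hne
  obtain ⟨v, rfl⟩ := hs
  rcases Sym2.mem_iff.1 hwa with rfl | rfl
  · exact hr _ hb _ ha m hm le_rfl (Or.inl ⟨⟨Ne.symm hne, not_crosses_of_common hwb hwa,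
      w, hwb, Or.inl (Sym2.mem_mk_right _ _)⟩, w, hwb, Sym2.mem_mk_right _ _⟩)
  · exact hr _ ha _ hb m hm le_rfl (Or.inl ⟨⟨hne, not_crosses_of_common hwa hwb,
      v, Sym2.mem_mk_left _ _, Or.inl hwb⟩, v, Sym2.mem_mk_left _ _, hwb⟩)

/-- A set containing a short diagonal and another diagonal is disconnected. -/
lemma disconnected_of_short {m : ℕ} (hm : 1 ≤ m) {S : Set (Sym2 (ZMod M))} (hr : MRigid m S)
    {a b : Sym2 (ZMod M)} (ha : a ∈ S) (hb : b ∈ S) (hne : a ≠ b) (hs : IsShort m a) :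
    ¬ ConnectedSet S := by
  intro hcon
  obtain ⟨x, hx⟩ : ∃ x, x ∈ a := ⟨_, Sym2.out_fst_mem a⟩
  obtain ⟨y, hy⟩ : ∃ y, y ∈ b := ⟨_, Sym2.out_fst_mem b⟩
  have hxS : ¬ Isolated S x := fun h => h a ha hx
  have hyS : ¬ Isolated S y := fun h => h b hb hy
  obtain ⟨w⟩ := hcon.preconnected ⟨x, hxS⟩ ⟨y, hyS⟩
  have walk : ∀ u v : {v : ZMod M | ¬ Isolated S v},
      ((graphOf S).induce {v : ZMod M | ¬ Isolated S v}).Walk u v → u.1 ∈ a → v.1 ∈ a := by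
    intro u v w
    induction w with
    | nil => exact id
    | @cons u v _ h _ ih =>
      intro hu
      apply ih
      have h' : s(u.1, v.1) ∈ S := by
        have : (graphOf S).Adj u.1 v.1 := h
        exact ((SimpleGraph.fromEdgeSet_adj _).1 this).1
      rw [short_disjoint hm hr ha h' hs hu (Sym2.mem_mk_left _ _)]
      exact Sym2.mem_mk_right _ _
  exact hne (short_disjoint hm hr ha hb hs (walk _ _ w hx) hy)

/-- Lemma 2.4. If a maximal `m`-rigid set contains a crossing, then the
induced subgraph of its graph on the non-isolated vertices is disconnected. -/
theorem crossing_disconnects (m n N : ℕ) (hm : 1 ≤ m) (hn : 2 ≤ n)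
    (hN : N = (m + 1) * (n + 1) - 2)
    (S : Set (Sym2 (ZMod N))) (hmax : MaxMRigid m S)
    (hcross : ∃ a ∈ S, ∃ b ∈ S, a ≠ b ∧ Crosses a b) :
    ¬ ConnectedSet S := by
  have : NeZero N := ⟨by
    have : (m + 1) * 3 ≤ (m + 1) * (n + 1) := Nat.mul_le_mul_left _ (by omega)
    omega⟩
  obtain ⟨a, ha, b, hb, hne, hc⟩ := hcross
  obtain ⟨hd, hr, -⟩ := hmax
  rcases short_of_cross hm hd hr ha hb hc with h | h
  · exact disconnected_of_short hm hr ha hb hne h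
  · exact disconnected_of_short hm hr hb ha (Ne.symm hne) h
end PaperTiling
end

section
/- Let v_1, …, v_r (r ≥ 3) be vertices of P_{n,m} with C(v_1,…,v_r) such that each pair {v_i, v_{i+1}} (indices taken modulo r) is an (m+1)-diagonal. Then m+1 divides r−2. -/
namespace PaperTiling

variable {M : ℕ}

/-- If `v₁, …, v_r` (`r ≥ 3`) occur in clockwise cyclic order and each
`{vᵢ, vᵢ₊₁}` (cyclically) is an `(m+1)`-diagonal, then `m+1` divides `r - 2`. -/
theorem cycle_length_mod (m n N : ℕ) (hm : 1 ≤ m) (hn : 2 ≤ n)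
    (hN : N = (m + 1) * (n + 1) - 2)
    (l : List (ZMod N)) (h3 : 3 ≤ l.length) (hcw : CW l)
    (hd : ∀ p ∈ l.zip (l.rotate 1), IsMDiag m s(p.1, p.2)) :
    (m + 1) ∣ (l.length - 2) := by
  obtain ⟨_, hs⟩ := hcw
  have h1 : (m + 1) ∣
      ((l.zip (l.rotate 1)).map fun p => (p.2 - p.1).val + 1).sum := by
    apply List.dvd_sum
    intro x hx
    obtain ⟨p, hp, rfl⟩ := List.mem_map.mp hx
    exact (hd p hp).2 p.1 p.2 rfl
  have h2 : ((l.zip (l.rotate 1)).map fun p => (p.2 - p.1).val + 1).sum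
      = N + l.length := by
    rw [List.sum_map_add, hs]
    simp
  rw [h2] at h1
  have h4 : 2 ≤ (m + 1) * (n + 1) := by nlinarith
  have h5 : N + l.length = (m + 1) * (n + 1) + (l.length - 2) := by omega
  rw [h5] at h1
  exact (Nat.dvd_add_right (Dvd.intro _ rfl)).mp h1
end PaperTiling
end
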